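/- Let Phi denote the cumulative distribution function of the standard normal distribution on R, define T(y) = -log(1 - Phi(y)), and let T^{-1} : (0, infinity) -> R be its inverse. Fix rho in (0, 1) and z in R. Then lim_{y -> infinity} Phi( ( T^{-1}( rho^2 * T(y) + (1 + rho * sqrt(T(y))) * z ) - rho * y ) / sqrt(1 - rho^2) ) = Phi( z / ( sqrt(2) * sqrt(1 - rho^2) ) ). -/

import Mathlib

open MeasureTheory Filter Topology

/-- The standard normal cumulative distribution function. -/
noncomputable def stdNormalCDF (y : ℝ) : ℝ :=
  ∫ t in Set.Iic y, (Real.sqrt (2 * Real.pi))⁻¹ * Real.exp (-t ^ 2 / 2)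

/-- The transformation to standard exponential margins. -/
noncomputable def expTransform (y : ℝ) : ℝ := -Real.log (1 - stdNormalCDF y)

noncomputable def gphi (t : ℝ) : ℝ := (Real.sqrt (2 * Real.pi))⁻¹ * Real.exp (-t ^ 2 / 2)

lemma gphi_eq : gphi = ProbabilityTheory.gaussianPDFReal 0 1 := by
  funext t
  simp [gphi, ProbabilityTheory.gaussianPDFReal]

lemma gphi_int : Integrable gphi := by
  rw [gphi_eq]; exact ProbabilityTheory.integrable_gaussianPDFReal 0 1

lemma gphi_one : ∫ t, gphi t = 1 := by
  rw [gphi_eq]; exact ProbabilityTheory.integral_gaussianPDFReal_eq_one 0 one_ne_zero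

lemma gphi_pos (t : ℝ) : 0 < gphi t := by
  unfold gphi; positivity

lemma cdf_eq (y : ℝ) : stdNormalCDF y = ∫ t in Set.Iic y, gphi t := rfl

lemma surv_eq (y : ℝ) : 1 - stdNormalCDF y = ∫ t in Set.Ioi y, gphi t := by
  have h := intervalIntegral.integral_Iic_add_Ioi (b := y) gphi_int.integrableOn
    gphi_int.integrableOn
  rw [gphi_one] at h
  rw [cdf_eq]; linarith

lemma cdf_cont : Continuous stdNormalCDF := by
  have h : stdNormalCDF = fun y => stdNormalCDF 0 + ∫ t in (0:ℝ)..y, gphi t := by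
    funext y
    have := intervalIntegral.integral_Iic_sub_Iic (a := 0) (b := y)
      gphi_int.integrableOn gphi_int.integrableOn
    rw [← this, cdf_eq, cdf_eq]; ring
  rw [h]
  exact continuous_const.add
    (intervalIntegral.continuous_primitive (fun a b => gphi_int.intervalIntegrable) 0)

lemma surv_upper {y : ℝ} (hy : 0 ≤ y) : 1 - stdNormalCDF y ≤ Real.exp (-y ^ 2 / 2) := by
  rw [surv_eq]
  have hi : Integrable (fun t => Real.exp (-y ^ 2 / 2) * gphi (t - y)) :=
    (gphi_int.comp_sub_right y).const_mul _
  calc ∫ t in Set.Ioi y, gphi t ≤ ∫ t in Set.Ioi y, Real.exp (-y ^ 2 / 2) * gphi (t - y) := by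
        apply setIntegral_mono_on gphi_int.integrableOn hi.integrableOn measurableSet_Ioi
        intro t ht
        have ht' : y < t := ht
        unfold gphi
        rw [mul_left_comm, ← Real.exp_add]
        gcongr
        nlinarith [mul_nonneg hy (sub_nonneg.2 ht'.le)]
    _ ≤ ∫ t, Real.exp (-y ^ 2 / 2) * gphi (t - y) := by
        apply setIntegral_le_integral hi
        exact Eventually.of_forall fun t => (mul_pos (Real.exp_pos _) (gphi_pos _)).le
    _ = Real.exp (-y ^ 2 / 2) := by
        rw [integral_const_mul, integral_sub_right_eq_self gphi y, gphi_one, mul_one]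

lemma surv_lower' {y h : ℝ} (hy : 0 ≤ y) (hh : 0 < h) :
    h * gphi (y + h) ≤ 1 - stdNormalCDF y := by
  rw [surv_eq]
  calc h * gphi (y + h) = ∫ t in Set.Ioc y (y + h), gphi (y + h) := by
        simp [hh.le]
    _ ≤ ∫ t in Set.Ioc y (y + h), gphi t := by
        apply setIntegral_mono_on (by simp) gphi_int.integrableOn
          measurableSet_Ioc
        intro t ht
        have h1 := ht.1
        have h2 := ht.2
        unfold gphi
        gcongr
        linarith
    _ ≤ _ := by
        apply setIntegral_mono_set gphi_int.integrableOn
        · exact Eventually.of_forall fun t => (gphi_pos t).le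
        · exact Set.Ioc_subset_Ioi_self.eventuallyLE

lemma surv_pos (y : ℝ) : 0 < 1 - stdNormalCDF y := by
  rw [surv_eq, setIntegral_pos_iff_support_of_nonneg_ae
    (Eventually.of_forall fun t => (gphi_pos t).le) gphi_int.integrableOn]
  have : Function.support gphi = Set.univ := by
    ext t; simp [(gphi_pos t).ne']
  simp [this]

lemma T_mono : Monotone expTransform := by
  intro a b hab
  unfold expTransform
  apply neg_le_neg
  apply Real.log_le_log (surv_pos b)
  rw [surv_eq, surv_eq]
  apply setIntegral_mono_set gphi_int.integrableOn
  · exact Eventually.of_forall fun t => (gphi_pos t).le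
  · exact (Set.Ioi_subset_Ioi hab).eventuallyLE

lemma T_lower {y : ℝ} (hy : 0 ≤ y) : y ^ 2 / 2 ≤ expTransform y := by
  unfold expTransform
  have := Real.log_le_log (surv_pos y) (surv_upper hy)
  rw [Real.log_exp] at this
  linarith

lemma T_upper {y : ℝ} (hy : 1 ≤ y) : expTransform y ≤
    y ^ 2 / 2 + 3 / 2 + Real.log y + Real.log (Real.sqrt (2 * Real.pi)) := by
  have hy0 : 0 < y := by linarith
  have h1 := Real.log_le_log (by have := gphi_pos (y + y⁻¹); positivity)
    (surv_lower' hy0.le (inv_pos.2 hy0))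
  rw [Real.log_mul (by positivity) (gphi_pos _).ne', gphi,
    Real.log_mul (by positivity) (Real.exp_pos _).ne', Real.log_exp, Real.log_inv,
    Real.log_inv] at h1
  have h2 : y * y⁻¹ = 1 := mul_inv_cancel₀ hy0.ne'
  have h3 : y⁻¹ ≤ 1 := inv_le_one_of_one_le₀ hy
  have h4 : 0 < y⁻¹ := inv_pos.2 hy0
  unfold expTransform
  nlinarith

lemma T_asymp : Tendsto (fun y => (expTransform y - y ^ 2 / 2) / y) atTop (𝓝 0) := by
  have hl : Tendsto (fun y : ℝ => Real.log y / y) atTop (𝓝 0) :=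
    Real.isLittleO_log_id_atTop.tendsto_div_nhds_zero
  have hc : Tendsto (fun y : ℝ => (3 / 2 + Real.log (Real.sqrt (2 * Real.pi))) / y) atTop (𝓝 0) :=
    tendsto_const_nhds.div_atTop tendsto_id
  have hs := hc.add hl
  rw [add_zero] at hs
  refine tendsto_of_tendsto_of_tendsto_of_le_of_le' tendsto_const_nhds hs ?_ ?_
  · filter_upwards [eventually_ge_atTop 1] with y hy
    have := T_lower (y := y) (by linarith)
    exact div_nonneg (by linarith) (by linarith)
  · filter_upwards [eventually_ge_atTop 1] with y hy
    have := T_upper hy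
    rw [← add_div]
    gcongr
    linarith

lemma sqrt_asymp : Tendsto (fun y => Real.sqrt (expTransform y) / y) atTop
    (𝓝 (1 / Real.sqrt 2)) := by
  have h1 : Tendsto (fun y : ℝ => (expTransform y - y ^ 2 / 2) / y * y⁻¹ + 1 / 2) atTop
      (𝓝 (0 * 0 + 1 / 2)) := (T_asymp.mul tendsto_inv_atTop_zero).add_const _
  have h2 := (Real.continuous_sqrt.tendsto _).comp h1
  have h3 : Real.sqrt (0 * 0 + 1 / 2) = 1 / Real.sqrt 2 := by
    rw [zero_mul, zero_add, Real.sqrt_div zero_le_one, Real.sqrt_one]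
  rw [h3] at h2
  refine h2.congr' ?_
  filter_upwards [eventually_gt_atTop 0] with y hy
  have : (expTransform y - y ^ 2 / 2) / y * y⁻¹ + 1 / 2 = expTransform y / y ^ 2 := by
    field_simp; ring
  simp only [Function.comp, this]
  rw [Real.sqrt_div' _ (by positivity), Real.sqrt_sq hy.le]

lemma key (ρ : ℝ) (hρ : 0 < ρ) (z δ : ℝ) :
    Tendsto (fun y => (expTransform (ρ * y + δ) -
      (ρ ^ 2 * expTransform y + (1 + ρ * Real.sqrt (expTransform y)) * z)) / y) atTop
      (𝓝 (ρ * (δ - z / Real.sqrt 2))) := by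
  have hlin : Tendsto (fun y : ℝ => ρ * y + δ) atTop atTop :=
    tendsto_atTop_add_const_right _ _ (tendsto_id.const_mul_atTop hρ)
  have hi := tendsto_inv_atTop_zero (𝕜 := ℝ)
  have hA := (T_asymp.comp hlin).mul ((hi.const_mul δ).const_add ρ)
  have hB := T_asymp.const_mul (ρ ^ 2)
  have hC := (hi.const_mul z)
  have hD := sqrt_asymp.const_mul (ρ * z)
  have hE := (hi.const_mul (δ ^ 2 / 2)).const_add (ρ * δ)
  have hall := (((hA.sub hB).sub hC).sub hD).add hE
  have e : 0 * (ρ + δ * 0) - ρ ^ 2 * 0 - z * 0 - ρ * z * (1 / Real.sqrt 2) +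
      (ρ * δ + δ ^ 2 / 2 * 0) = ρ * (δ - z / Real.sqrt 2) := by ring
  rw [e] at hall
  refine hall.congr' ?_
  filter_upwards [eventually_gt_atTop 0, hlin.eventually_gt_atTop 0] with y hy hy2
  simp only [Function.comp]
  have hne := hy2.ne'
  field_simp
  ring

/-- Conditional extreme value limit for the Gaussian copula: for `ρ ∈ (0,1)` and `z ∈ ℝ`,
`Φ((T⁻¹(ρ² T(y) + (1 + ρ √(T(y))) z) - ρ y)/√(1-ρ²)) → Φ(z/(√2 √(1-ρ²)))` as `y → ∞`. -/
theorem gaussian_copula_conditional_limit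
    (Tinv : ℝ → ℝ)
    (hleft : ∀ y : ℝ, Tinv (expTransform y) = y)
    (hright : ∀ x : ℝ, 0 < x → expTransform (Tinv x) = x)
    (ρ : ℝ) (hρ : ρ ∈ Set.Ioo (0 : ℝ) 1) (z : ℝ) :
    Tendsto (fun y => stdNormalCDF
        ((Tinv (ρ ^ 2 * expTransform y + (1 + ρ * Real.sqrt (expTransform y)) * z) - ρ * y) /
          Real.sqrt (1 - ρ ^ 2)))
      atTop (𝓝 (stdNormalCDF (z / (Real.sqrt 2 * Real.sqrt (1 - ρ ^ 2))))) := by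
  have h0 := hρ.1
  have hlin (δ : ℝ) : Tendsto (fun y : ℝ => ρ * y + δ) atTop atTop :=
    tendsto_atTop_add_const_right _ _ (tendsto_id.const_mul_atTop h0)
  -- the argument of `Tinv` is eventually positive
  have hpos : ∀ᶠ y in atTop,
      0 < ρ ^ 2 * expTransform y + (1 + ρ * Real.sqrt (expTransform y)) * z := by
    have hT : Tendsto expTransform atTop atTop := by
      refine tendsto_atTop_mono' atTop (f₁ := fun y : ℝ => y / 2) ?_
        (tendsto_id.atTop_div_const two_pos)
      filter_upwards [eventually_ge_atTop 1] with y hy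
      have := T_lower (y := y) (by linarith)
      nlinarith
    have hs : Tendsto (fun y => Real.sqrt (expTransform y)) atTop atTop :=
      Real.tendsto_sqrt_atTop.comp hT
    have hq : Tendsto (fun y => ρ ^ 2 * Real.sqrt (expTransform y) + ρ * z) atTop atTop :=
      tendsto_atTop_add_const_right _ _ (hs.const_mul_atTop (by positivity))
    have hm := tendsto_atTop_add_const_right _ z (hs.atTop_mul_atTop₀ hq)
    filter_upwards [hm.eventually_gt_atTop 0, hT.eventually_gt_atTop 0] with y hy hy2
    have := Real.mul_self_sqrt hy2.le
    nlinarith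
  have hmain : Tendsto (fun y =>
      Tinv (ρ ^ 2 * expTransform y + (1 + ρ * Real.sqrt (expTransform y)) * z) - ρ * y)
      atTop (𝓝 (z / Real.sqrt 2)) := by
    rw [tendsto_order]
    constructor
    · intro δ hδ
      have hk := (key ρ h0 z δ).eventually_lt_const
        (mul_neg_of_pos_of_neg h0 (sub_neg.2 hδ))
      filter_upwards [hk, hpos, eventually_gt_atTop 0] with y hy hp hy0
      have h1 := sub_neg.1 ((div_neg_iff.1 hy).resolve_left (by rintro ⟨-, h⟩; linarith)).1
      rw [← hright _ hp] at h1
      have := T_mono.reflect_lt h1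
      linarith
    · intro δ hδ
      have hk := (key ρ h0 z δ).eventually_const_lt
        (mul_pos h0 (sub_pos.2 hδ))
      filter_upwards [hk, hpos, eventually_gt_atTop 0] with y hy hp hy0
      have h1 := sub_pos.1 ((div_pos_iff_of_pos_right hy0).1 hy)
      rw [← hright _ hp] at h1
      have := T_mono.reflect_lt h1
      linarith
  have := (cdf_cont.tendsto _).comp (hmain.div_const (Real.sqrt (1 - ρ ^ 2)))
  rw [div_div] at this
  exact this
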